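/- Let G = (V,E) be a graph, let W ⊆ U ⊆ V with W finite, and let r > t > 0. Assume that W ⊆ N_r(V) (every vertex of W has at least r neighbors) and W ∩ N_t(U) = ∅ (no vertex of W has t or more neighbors in U). Then |∂(W,U)| ≤ (t/(r−t))·|∂(W, V \ U)|. -/

import Mathlib

open scoped Classical

namespace AF3Potts

variable {Vt : Type*}

/-- `N_t(A)`: vertices having at least `t` neighbors in `A`. -/
def Nt (G : SimpleGraph Vt) (t : ℝ) (A : Set Vt) : Set Vt :=
  {v | t ≤ ((G.neighborSet v ∩ A).ncard : ℝ)}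

/-- `∂(A,B)`: the set of edges with one endpoint in `A` and the other in `B`. -/
def edgesBtwG (G : SimpleGraph Vt) (A B : Set Vt) : Set (Sym2 Vt) :=
  {e | e ∈ G.edgeSet ∧ ∃ a b, e = s(a, b) ∧ a ∈ A ∧ b ∈ B}

theorem edgesBtwG_eq_biUnion (G : SimpleGraph Vt) (A B : Set Vt) :
    edgesBtwG G A B = ⋃ w ∈ A, (fun b => s(w, b)) '' (G.neighborSet w ∩ B) := by
  ext e
  simp only [edgesBtwG, Set.mem_ofPred_eq, Set.mem_iUnion, Set.mem_image, Set.mem_inter_iff,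
    SimpleGraph.mem_neighborSet, exists_prop]
  constructor
  · rintro ⟨he, a, b, rfl, ha, hb⟩
    exact ⟨a, ha, b, ⟨by simpa using he, hb⟩, rfl⟩
  · rintro ⟨a, ha, b, ⟨hab, hb⟩, rfl⟩
    exact ⟨by simpa using hab, a, b, rfl, ha, hb⟩

theorem ncard_image_sym2Mk (w : Vt) (S : Set Vt) :
    ((fun b => s(w, b)) '' S).ncard = S.ncard :=
  Set.ncard_image_of_injective _ fun _ _ h => Sym2.congr_right.mp h

theorem ncard_edgesBtwG_le (G : SimpleGraph Vt) {A : Set Vt} (hA : A.Finite) (B : Set Vt) :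
    (edgesBtwG G A B).ncard ≤ ∑ w ∈ hA.toFinset, (G.neighborSet w ∩ B).ncard := by
  rw [edgesBtwG_eq_biUnion]
  simpa [ncard_image_sym2Mk] using
    hA.toFinset.set_ncard_biUnion_le fun w => (fun b => s(w, b)) '' (G.neighborSet w ∩ B)

theorem ncard_edgesBtwG_of_disjoint (G : SimpleGraph Vt) {A B : Set Vt} (hA : A.Finite)
    (hAB : Disjoint A B) (hfin : ∀ w ∈ A, (G.neighborSet w ∩ B).Finite) :
    (edgesBtwG G A B).ncard = ∑ w ∈ hA.toFinset, (G.neighborSet w ∩ B).ncard := by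
  rw [edgesBtwG_eq_biUnion, hA.ncard_biUnion fun w hw => (hfin w hw).image _]
  · simp only [ncard_image_sym2Mk]
    exact finsum_mem_eq_finite_toFinset_sum _ hA
  · intro v hv w hw hvw
    refine Set.disjoint_left.mpr ?_
    rintro _ ⟨b, _, rfl⟩ ⟨c, hc, h⟩
    rcases Sym2.eq_iff.mp h with ⟨rfl, _⟩ | ⟨_, rfl⟩
    · exact hvw rfl
    · exact Set.disjoint_left.mp hAB hv hc.2

/-- Lemma 2.9. If `W ⊆ U`, `W` is finite, every vertex of `W`
has at least `r` neighbors, and no vertex of `W` has `t` or more neighbors in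
`U` (`r > t > 0`), then `|∂(W,U)| ≤ (t/(r−t))·|∂(W,Uᶜ)|`. -/
theorem statement9 (G : SimpleGraph Vt) (W U : Set Vt) (hWU : W ⊆ U)
    (hWfin : W.Finite) (r t : ℝ) (hrt : t < r) (ht : 0 < t)
    (hWr : W ⊆ Nt G r Set.univ) (hWt : W ∩ Nt G t U = ∅) :
    ((edgesBtwG G W U).ncard : ℝ) ≤
      (t / (r - t)) * ((edgesBtwG G W Uᶜ).ncard : ℝ) := by
  have hfin : ∀ w ∈ W, (G.neighborSet w).Finite := by
    intro w hw
    have h : r ≤ ((G.neighborSet w ∩ Set.univ).ncard : ℝ) := hWr hw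
    rw [Set.inter_univ] at h
    refine Set.finite_of_ncard_pos ?_
    exact_mod_cast (ht.trans hrt).trans_le h
  have hdeg : ∀ w ∈ W, ((G.neighborSet w ∩ U).ncard : ℝ) ≤
      t / (r - t) * ((G.neighborSet w ∩ Uᶜ).ncard : ℝ) := by
    intro w hw
    have h : r ≤ ((G.neighborSet w ∩ Set.univ).ncard : ℝ) := hWr hw
    have hU : ((G.neighborSet w ∩ U).ncard : ℝ) < t := by
      by_contra! hU
      exact Set.notMem_empty w (hWt ▸ ⟨hw, hU⟩)
    have hsplit : ((G.neighborSet w ∩ U).ncard : ℝ) + ((G.neighborSet w ∩ Uᶜ).ncard : ℝ) =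
        ((G.neighborSet w).ncard : ℝ) := by
      rw [← Set.sdiff_eq]
      exact_mod_cast Set.ncard_inter_add_ncard_sdiff_eq_ncard _ U (hfin w hw)
    rw [Set.inter_univ] at h
    rw [div_mul_eq_mul_div, le_div_iff₀ (sub_pos.mpr hrt)]
    nlinarith
  have hdisj : Disjoint W Uᶜ := Set.disjoint_compl_right_iff_subset.mpr hWU
  rw [ncard_edgesBtwG_of_disjoint G hWfin hdisj fun w hw => (hfin w hw).inter_of_left _]
  calc ((edgesBtwG G W U).ncard : ℝ)
      ≤ ∑ w ∈ hWfin.toFinset, ((G.neighborSet w ∩ U).ncard : ℝ) := by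
        exact_mod_cast ncard_edgesBtwG_le G hWfin U
    _ ≤ ∑ w ∈ hWfin.toFinset, t / (r - t) * ((G.neighborSet w ∩ Uᶜ).ncard : ℝ) :=
        Finset.sum_le_sum fun w hw => hdeg w (hWfin.mem_toFinset.mp hw)
    _ = _ := by rw [← Finset.mul_sum, Nat.cast_sum]

end AF3Potts
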